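/- Let (M, I(M)) be a pi-space and let F, G be flats of finite rank. Then the join F ∨ G (the intersection of all flats containing both F and G) is a flat of finite rank. Moreover, if σ ⊆ F and τ ⊆ G are independent sets with |σ| = rk(F) and |τ| = rk(G), then F ∨ G = Cl(σ ∪ τ). -/

import Mathlib

open Set

/-- A pre-independence space (pi-space): a non-empty ground set `M` together with a
non-empty collection `Ind` of subsets of `M` (the independent sets) that is closed
under taking subsets (I1) and satisfies the finite exchange property (I2). -/
structure PiSpace (α : Type*) where
  M : Set α
  Ind : Set (Set α)
  M_nonempty : M.Nonempty
  Ind_nonempty : Ind.Nonempty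
  ind_subset_M : ∀ σ ∈ Ind, σ ⊆ M
  downward_closed : ∀ σ ∈ Ind, ∀ τ ⊆ σ, τ ∈ Ind
  exchange : ∀ σ ∈ Ind, ∀ τ ∈ Ind, σ.Finite → τ.Finite → τ.ncard < σ.ncard →
    ∃ x ∈ σ \ τ, insert x τ ∈ Ind

namespace PiSpace

variable {α : Type*}

/-- Condition (FC): a pi-space is a finitary matroid if every set all of whose finite
subsets are independent is itself independent. -/
def Finitary (P : PiSpace α) : Prop :=
  ∀ σ ⊆ P.M, (∀ τ ⊆ σ, τ.Finite → τ ∈ P.Ind) → σ ∈ P.Ind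

/-- The set of finite independent sets `I(M)_fin`. -/
def IndFin (P : PiSpace α) : Set (Set α) := {σ ∈ P.Ind | σ.Finite}

/-- The family `I(M)_W` of sets all of whose finite subsets are independent. -/
def IndW (P : PiSpace α) : Set (Set α) :=
  {σ | σ ⊆ P.M ∧ ∀ τ ⊆ σ, τ.Finite → τ ∈ P.Ind}

/-- The independent sets contained in `N`, i.e. `I(M,N)`. -/
def restrictInd (P : PiSpace α) (N : Set α) : Set (Set α) := {σ ∈ P.Ind | σ ⊆ N}

/-- `I(M.X)`: independent sets of the contraction of `M` by `M \ X`. -/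
def contractInd (P : PiSpace α) (X : Set α) : Set (Set α) :=
  {σ ∈ P.restrictInd X | ∃ τ ∈ P.restrictInd (P.M \ X),
    (∀ ρ ∈ P.restrictInd (P.M \ X), τ ⊆ ρ → ρ = τ) ∧ σ ∪ τ ∈ P.Ind}

/-- The rank of a subset `X`: the supremum of the cardinalities (in `ℕ∞`) of the
independent sets contained in `X`. -/
noncomputable def rk (P : PiSpace α) (X : Set α) : ℕ∞ :=
  ⨆ σ ∈ {σ : Set α | σ ∈ P.Ind ∧ σ ⊆ X}, σ.encard

/-- A flat of a pi-space. -/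
def IsFlat (P : PiSpace α) (F : Set α) : Prop :=
  F ⊆ P.M ∧ ∀ x ∈ P.M \ F, ∀ σ ∈ P.Ind, σ ⊆ F → insert x σ ∈ P.Ind

/-- The set of loops `0_{I(M)}`. -/
def loops (P : PiSpace α) : Set α := {x ∈ P.M | {x} ∉ P.Ind}

/-- A dependent subset of `M`. -/
def Dep (P : PiSpace α) (X : Set α) : Prop := X ⊆ P.M ∧ X ∉ P.Ind

/-- A circuit: a minimal dependent set. -/
def IsCircuit (P : PiSpace α) (C : Set α) : Prop :=
  P.Dep C ∧ ∀ C' ⊂ C, C' ∈ P.Ind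

/-- The closure of a subset `X`. -/
def cl (P : PiSpace α) (X : Set α) : Set α :=
  X ∪ {x ∈ P.M | ∃ C, P.IsCircuit C ∧ x ∈ C ∧ C ⊆ X ∪ {x}}

/-- The join of two flats: the intersection of all flats containing both. -/
def flatJoin (P : PiSpace α) (F G : Set α) : Set α :=
  ⋂₀ {H | P.IsFlat H ∧ F ⊆ H ∧ G ⊆ H}

/-- `Φ(σ)`: the intersection of all flats containing `σ`. -/
def Phi (P : PiSpace α) (σ : Set α) : Set α := ⋂₀ {F | P.IsFlat F ∧ σ ⊆ F}

/-- A finitely closed set: it contains the closure of each of its finite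
independent subsets. -/
def FinitelyClosed (P : PiSpace α) (X : Set α) : Prop :=
  ∀ σ ∈ P.Ind, σ ⊆ X → σ.Finite → P.cl σ ⊆ X

/-- An atom of the poset of flats: a flat strictly containing the loops and
minimal with this property. -/
def IsFlatAtom (P : PiSpace α) (A : Set α) : Prop :=
  P.IsFlat A ∧ P.loops ⊂ A ∧ ∀ F, P.IsFlat F → P.loops ⊂ F → F ⊆ A → F = A

end PiSpace

/-- Flats of an arbitrary pair (ground set, family of independent sets). -/
def IsFlatIn {α : Type*} (Mset : Set α) (Ind : Set (Set α)) (F : Set α) : Prop :=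
  F ⊆ Mset ∧ ∀ x ∈ Mset \ F, ∀ σ ∈ Ind, σ ⊆ F → insert x σ ∈ Ind

/-- The rank of `X` with respect to a family `Ind` of independent sets. -/
noncomputable def rkIn {α : Type*} (Ind : Set (Set α)) (X : Set α) : ℕ∞ :=
  ⨆ σ ∈ {σ : Set α | σ ∈ Ind ∧ σ ⊆ X}, σ.encard

namespace PiSpace

variable {α : Type*}

theorem encard_le_rk (P : PiSpace α) {X σ : Set α} (hσ : σ ∈ P.Ind) (hX : σ ⊆ X) :
    σ.encard ≤ P.rk X :=
  le_iSup₂_of_le (f := fun (σ : Set α) (_ : σ ∈ {σ : Set α | σ ∈ P.Ind ∧ σ ⊆ X}) => σ.encard)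
    σ ⟨hσ, hX⟩ le_rfl

theorem empty_mem_ind (P : PiSpace α) : ∅ ∈ P.Ind :=
  P.Ind_nonempty.elim fun σ hσ => P.downward_closed σ hσ ∅ (empty_subset σ)

theorem exists_ind_encard_eq_rk (P : PiSpace α) {X : Set α} (h : P.rk X < ⊤) :
    ∃ σ ∈ P.Ind, σ ⊆ X ∧ σ.encard = P.rk X := by
  have h' : sSup (Set.encard '' {σ : Set α | σ ∈ P.Ind ∧ σ ⊆ X}) = P.rk X := sSup_image
  have : Nonempty (Set.encard '' {σ : Set α | σ ∈ P.Ind ∧ σ ⊆ X}) :=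
    ⟨_, mem_image_of_mem _ ⟨P.empty_mem_ind, empty_subset X⟩⟩
  obtain ⟨σ, ⟨hσ, hX⟩, h⟩ := ENat.sSup_mem_of_nonempty_of_lt_top (h'.trans_lt h)
  exact ⟨σ, hσ, hX, h.trans h'⟩

theorem exists_maximal_ind_between (P : PiSpace α) {σ S : Set α} (hS : S.Finite)
    (hσ : σ ∈ P.Ind) (hσS : σ ⊆ S) :
    ∃ B ∈ P.Ind, σ ⊆ B ∧ B ⊆ S ∧ ∀ x ∈ S, insert x B ∈ P.Ind → x ∈ B := by
  obtain ⟨B, hσB, hB⟩ := (hS.finite_subsets.subset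
    (fun _ h => h.2 : {X | X ∈ P.Ind ∧ X ⊆ S} ⊆ {X | X ⊆ S})).exists_le_maximal ⟨hσ, hσS⟩
  exact ⟨B, hB.prop.1, hσB, hB.prop.2, fun x hx h =>
    hB.le_of_ge ⟨h, insert_subset hx hB.prop.2⟩ (subset_insert x B) (mem_insert x B)⟩

theorem exists_isCircuit_subset (P : PiSpace α) {X : Set α} (hX : X.Finite) (h : P.Dep X) :
    ∃ C ⊆ X, P.IsCircuit C := by
  obtain ⟨C, hCX, hC⟩ := (hX.finite_subsets.subset
    (fun _ h => h.2 : {Y | P.Dep Y ∧ Y ⊆ X} ⊆ {Y | Y ⊆ X})).exists_le_minimal ⟨h, Subset.rfl⟩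
  refine ⟨C, hCX, hC.prop.1, fun C' hC' => ?_⟩
  by_contra h'
  exact hC'.2 (hC.le_of_le ⟨⟨hC'.1.trans hC.prop.1.1, h'⟩, hC'.1.trans hCX⟩ hC'.1)

/-- The span of `B`: the points of `M` that lie in `B` or are dependent on `B`. -/
def indSpan (P : PiSpace α) (B : Set α) : Set α := {x ∈ P.M | insert x B ∈ P.Ind → x ∈ B}

theorem encard_le_of_subset_indSpan (P : PiSpace α) {B ρ : Set α} (hB : B ∈ P.Ind)
    (hBf : B.Finite) (hρ : ρ ∈ P.Ind) (h : ρ ⊆ P.indSpan B) : ρ.encard ≤ B.encard := by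
  by_contra! hlt
  obtain ⟨ρ', hρ', hcard⟩ := exists_subset_encard_eq (Order.add_one_le_of_lt hlt)
  have hρf : ρ'.Finite := finite_of_encard_eq_coe (k := B.ncard + 1) (by
    rw [hcard, ← hBf.cast_ncard_eq, Nat.cast_add_one])
  obtain ⟨x, hx, hxB⟩ := P.exchange ρ' (P.downward_closed ρ hρ ρ' hρ') B hB hρf hBf (by
    rw [← hρf.cast_ncard_eq, ← hBf.cast_ncard_eq] at hcard
    norm_cast at hcard
    omega)
  exact hx.2 ((h (hρ' hx.1)).2 hxB)

theorem isFlat_indSpan (P : PiSpace α) {B : Set α} (hB : B ∈ P.Ind) (hBf : B.Finite) :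
    P.IsFlat (P.indSpan B) := by
  refine ⟨fun x hx => hx.1, fun x hx σ hσ hσB => ?_⟩
  have hxB : insert x B ∈ P.Ind ∧ x ∉ B := by
    by_contra h
    exact hx.2 ⟨hx.1, fun h' => by tauto⟩
  have hσf : σ.Finite := finite_of_encard_le_coe (k := B.ncard) (by
    rw [hBf.cast_ncard_eq]; exact P.encard_le_of_subset_indSpan hB hBf hσ hσB)
  have hBs : B ⊆ P.indSpan B := fun y hy => ⟨P.ind_subset_M B hB hy, fun _ => hy⟩
  obtain ⟨σ', hσ', hσσ', hσ'S, hmax⟩ := P.exists_maximal_ind_between (hσf.union hBf) hσ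
    subset_union_left
  have hσ'f := (hσf.union hBf).subset hσ'S
  have hle := P.encard_le_of_subset_indSpan hB hBf hσ' (hσ'S.trans (union_subset hσB hBs))
  obtain ⟨y, hy, hyI⟩ := P.exchange _ hxB.1 σ' hσ' (hBf.insert x) hσ'f (by
    rw [ncard_insert_of_notMem hxB.2 hBf]
    rw [← hσ'f.cast_ncard_eq, ← hBf.cast_ncard_eq] at hle
    norm_cast at hle
    omega)
  obtain rfl | hyB := hy.1
  · exact P.downward_closed _ hyI _ (insert_subset_insert hσσ')
  · exact absurd (hmax y (Or.inr hyB) hyI) hy.2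

theorem IsFlat.subset_of_encard_eq_rk {P : PiSpace α} {F H σ : Set α} (hH : P.IsFlat H)
    (hFM : F ⊆ P.M) (hFr : P.rk F < ⊤) (hσ : σ ∈ P.Ind) (hσF : σ ⊆ F) (hσH : σ ⊆ H)
    (h : σ.encard = P.rk F) : F ⊆ H := by
  intro x hx
  by_contra hxH
  have hle := P.encard_le_rk (hH.2 x ⟨hFM hx, hxH⟩ σ hσ hσH) (insert_subset hx hσF)
  rw [encard_insert_of_notMem fun hxσ => hxH (hσH hxσ), h] at hle
  exact (ENat.lt_add_one_iff hFr.ne).2 le_rfl |>.not_ge hle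

theorem IsFlat.indSpan_subset {P : PiSpace α} {H B : Set α} (hH : P.IsFlat H) (hB : B ∈ P.Ind)
    (hBH : B ⊆ H) : P.indSpan B ⊆ H := by
  intro x hx
  by_contra hxH
  exact hxH (hBH (hx.2 (hH.2 x ⟨hx.1, hxH⟩ B hB hBH)))

theorem IsFlat.cl_subset {P : PiSpace α} {H S : Set α} (hH : P.IsFlat H) (hS : S ⊆ H) :
    P.cl S ⊆ H := by
  rintro x (hx | ⟨hxM, C, hC, hxC, hCS⟩)
  · exact hS hx
  · by_contra hxH
    have hsub : C \ {x} ⊆ H := fun y hy => (hCS hy.1).elim (fun h => hS h) fun h => absurd h hy.2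
    have hI := hH.2 x ⟨hxM, hxH⟩ (C \ {x}) (hC.2 _ (sdiff_singleton_ssubset.2 hxC)) hsub
    rw [insert_sdiff_singleton, insert_eq_of_mem hxC] at hI
    exact hC.1.2 hI

theorem indSpan_subset_cl (P : PiSpace α) {B S : Set α} (hB : B ∈ P.Ind) (hBf : B.Finite)
    (hBS : B ⊆ S) : P.indSpan B ⊆ P.cl S := by
  intro x hx
  by_cases hxB : x ∈ B
  · exact Or.inl (hBS hxB)
  · obtain ⟨C, hCX, hC⟩ := P.exists_isCircuit_subset (hBf.insert x)
      ⟨insert_subset hx.1 (P.ind_subset_M B hB), fun h => hxB (hx.2 h)⟩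
    refine Or.inr ⟨hx.1, C, hC, ?_, fun y hy => (hCX hy).elim Or.inr fun h => Or.inl (hBS h)⟩
    by_contra hxC
    exact hC.1.2 (P.downward_closed B hB C ((subset_insert_iff_of_notMem hxC).1 hCX))

theorem IsFlat.join_eq_cl {P : PiSpace α} {F G σ τ : Set α} (hF : P.IsFlat F) (hG : P.IsFlat G)
    (hFr : P.rk F < ⊤) (hGr : P.rk G < ⊤) (hσ : σ ∈ P.Ind) (hτ : τ ∈ P.Ind) (hσF : σ ⊆ F)
    (hτG : τ ⊆ G) (hσr : σ.encard = P.rk F) (hτr : τ.encard = P.rk G) :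
    P.IsFlat (P.flatJoin F G) ∧ P.rk (P.flatJoin F G) < ⊤ ∧
      P.flatJoin F G = P.cl (σ ∪ τ) := by
  have hSf : (σ ∪ τ).Finite :=
    (encard_lt_top_iff.1 (hσr ▸ hFr)).union (encard_lt_top_iff.1 (hτr ▸ hGr))
  obtain ⟨B, hB, -, hBS, hmax⟩ :=
    P.exists_maximal_ind_between hSf P.empty_mem_ind (empty_subset _)
  have hBf := hSf.subset hBS
  have hH := P.isFlat_indSpan hB hBf
  have hSH : σ ∪ τ ⊆ P.indSpan B := fun x hx =>
    ⟨union_subset (P.ind_subset_M σ hσ) (P.ind_subset_M τ hτ) hx, hmax x hx⟩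
  have hjoin : P.flatJoin F G = P.indSpan B := by
    refine Subset.antisymm (sInter_subset_of_mem ⟨hH, ?_, ?_⟩)
      (subset_sInter fun K hK => hK.1.indSpan_subset hB
        (hBS.trans (union_subset (hσF.trans hK.2.1) (hτG.trans hK.2.2))))
    · exact hH.subset_of_encard_eq_rk hF.1 hFr hσ hσF (subset_union_left.trans hSH) hσr
    · exact hH.subset_of_encard_eq_rk hG.1 hGr hτ hτG (subset_union_right.trans hSH) hτr
  rw [hjoin]
  refine ⟨hH, lt_of_le_of_lt (iSup₂_le fun ρ hρ => ?_) hBf.encard_lt_top,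
    Subset.antisymm (P.indSpan_subset_cl hB hBf hBS) (hH.cl_subset hSH)⟩
  exact P.encard_le_of_subset_indSpan hB hBf hρ.1 hρ.2

end PiSpace

/-- The join of two flats of finite rank is a flat of finite rank;
moreover, if `σ ⊆ F` and `τ ⊆ G` are independent sets realizing the ranks of `F`
and `G`, then `F ∨ G = Cl(σ ∪ τ)`. -/
theorem join_of_finite_rank_flats {α : Type*} (P : PiSpace α) (F G : Set α)
    (hF : P.IsFlat F) (hG : P.IsFlat G) (hFr : P.rk F < ⊤) (hGr : P.rk G < ⊤) :
    (P.IsFlat (P.flatJoin F G) ∧ P.rk (P.flatJoin F G) < ⊤) ∧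
    (∀ σ ∈ P.Ind, ∀ τ ∈ P.Ind, σ ⊆ F → τ ⊆ G →
      σ.encard = P.rk F → τ.encard = P.rk G →
      P.flatJoin F G = P.cl (σ ∪ τ)) := by
  refine ⟨?_, fun σ hσ τ hτ hσF hτG hσr hτr =>
    (hF.join_eq_cl hG hFr hGr hσ hτ hσF hτG hσr hτr).2.2⟩
  obtain ⟨σ, hσ, hσF, hσr⟩ := P.exists_ind_encard_eq_rk hFr
  obtain ⟨τ, hτ, hτG, hτr⟩ := P.exists_ind_encard_eq_rk hGr
  have h := hF.join_eq_cl hG hFr hGr hσ hτ hσF hτG hσr hτr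
  exact ⟨h.1, h.2.1⟩
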